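/- For all 0 ≤ s < t and all R > 0: ∫_{[−R,R]⁴} ∫_ℝ ∫_ℝ ∫_s^t ∫_ℝ p_{t−s}(x−y)·p_{t−s}(x′−y′)·p_{t−r}(x̃−z)·p_{t−r}(x̃′−z)·p_{r−s}(z−y)·p_{r−s}(z−y′) dz dr dy dy′ dx dx′ dx̃ dx̃′ ≤ 2R·(t−s), where (x, x′, x̃, x̃′) range over [−R,R]⁴, y, y′, z range over ℝ, and r ranges over (s, t). -/

import Mathlib

open MeasureTheory

/-- The one-dimensional heat kernel `p_t(x) = (2πt)^{-1/2} exp(-x²/(2t))`. -/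
noncomputable def heatKernel (t x : ℝ) : ℝ :=
  (Real.sqrt (2 * Real.pi * t))⁻¹ * Real.exp (-x ^ 2 / (2 * t))

open scoped ENNReal

lemma measurable_heatKernel : Measurable (Function.uncurry heatKernel) := by
  unfold heatKernel Function.uncurry
  fun_prop

lemma lintegral_enorm_heatKernel {a : ℝ} (ha : 0 < a) : ∫⁻ x, ‖heatKernel a x‖ₑ = 1 := by
  have hv : a.toNNReal ≠ 0 := by simpa using ha
  rw [← ProbabilityTheory.lintegral_gaussianPDF_eq_one 0 hv]
  refine lintegral_congr fun x => ?_
  have h : heatKernel a x = ProbabilityTheory.gaussianPDFReal 0 a.toNNReal x := by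
    simp [heatKernel, ProbabilityTheory.gaussianPDFReal, ha.le]
  rw [h, Real.enorm_of_nonneg (ProbabilityTheory.gaussianPDFReal_nonneg _ _ _),
    ProbabilityTheory.gaussianPDF]

/-- A nested integral is controlled by the nested lower integral, without any measurability. -/
lemma enorm_integral_le_of_enorm_le {α : Type*} [MeasurableSpace α] {μ : Measure α}
    {f : α → ℝ} {g : α → ℝ≥0∞} (h : ∀ x, ‖f x‖ₑ ≤ g x) : ‖∫ x, f x ∂μ‖ₑ ≤ ∫⁻ x, g x ∂μ :=
  (enorm_integral_le_lintegral_enorm _).trans (lintegral_mono h)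

/-- Tonelli for a two-parameter family of unit-mass densities. -/
lemma lintegral_lintegral_mul_of_lintegral_eq_one {α : Type*} [MeasurableSpace α]
    {ν : Measure ℝ} {μ : Measure α} [SFinite ν] [SFinite μ] {k : ℝ → α → ℝ≥0∞} {g : α → ℝ≥0∞}
    (hk : Measurable (Function.uncurry k)) (hg : Measurable g)
    (h : ∀ᵐ a ∂μ, ∫⁻ x, k x a ∂ν = 1) :
    ∫⁻ x, ∫⁻ a, k x a * g a ∂μ ∂ν = ∫⁻ a, g a ∂μ := by
  rw [lintegral_lintegral_swap (by fun_prop)]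
  refine lintegral_congr_ae ?_
  filter_upwards [h] with a ha
  rw [lintegral_mul_const _ (by fun_prop), ha, one_mul]

/-- The nested lower integral of the product of unit-mass kernels, the first, second and fourth
spatial variables running over all of `ℝ`, is the size of the remaining domain. -/
lemma lintegral_kernel_product_eq {k : ℝ → ℝ → ℝ≥0∞} (hk : Measurable (Function.uncurry k))
    (hk_one : ∀ a, 0 < a → ∫⁻ x, k a x = 1) {s t : ℝ} (hst : s < t) (S : Set ℝ) :
    (∫⁻ x, ∫⁻ x', ∫⁻ xt in S, ∫⁻ xt', ∫⁻ y, ∫⁻ y', ∫⁻ r in Set.Ioo s t, ∫⁻ z,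
        k (t - s) (x - y) * k (t - s) (x' - y') * k (t - r) (xt - z) * k (t - r) (xt' - z) *
          k (r - s) (z - y) * k (r - s) (z - y')) =
      ENNReal.ofReal (t - s) * volume S := by
  have h_fst (a : ℝ) (ha : 0 < a) (y : ℝ) : ∫⁻ x, k a (x - y) = 1 := by
    rw [lintegral_sub_right_eq_self (fun x => k a x), hk_one a ha]
  have h_snd (a : ℝ) (ha : 0 < a) (x : ℝ) : ∫⁻ y, k a (x - y) = 1 := by
    rw [lintegral_sub_left_eq_self (fun x => k a x), hk_one a ha]
  have hts : 0 < t - s := sub_pos.2 hst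
  have h_absorb (k' : ℝ → ℝ → ℝ → ℝ≥0∞) (hk' : Measurable fun p : ℝ × ℝ × ℝ => k' p.1 p.2.1 p.2.2)
      (h_one : ∀ r ∈ Set.Ioo s t, ∀ z, ∫⁻ x, k' x r z = 1) (g : ℝ → ℝ → ℝ≥0∞)
      (hg : Measurable (Function.uncurry g)) :
      ∫⁻ x, ∫⁻ r in Set.Ioo s t, ∫⁻ z, k' x r z * g r z =
        ∫⁻ r in Set.Ioo s t, ∫⁻ z, g r z := by
    rw [lintegral_lintegral_swap (by fun_prop)]
    refine setLIntegral_congr_fun measurableSet_Ioo fun r hr => ?_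
    exact lintegral_lintegral_mul_of_lintegral_eq_one (by fun_prop) (by fun_prop)
      (.of_forall fun z => h_one r hr z)
  calc
    _ = ∫⁻ x', ∫⁻ xt in S, ∫⁻ xt', ∫⁻ y, ∫⁻ y', ∫⁻ r in Set.Ioo s t, ∫⁻ z,
        k (t - s) (x' - y') * (k (t - r) (xt - z) * k (t - r) (xt' - z) *
          k (r - s) (z - y) * k (r - s) (z - y')) := by
      simp_rw [mul_assoc]
      rw [lintegral_lintegral_swap (by fun_prop)]
      refine lintegral_congr fun x' => ?_
      rw [lintegral_lintegral_swap (by fun_prop)]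
      refine lintegral_congr fun xt => ?_
      rw [lintegral_lintegral_swap (by fun_prop)]
      refine lintegral_congr fun xt' => ?_
      rw [lintegral_lintegral_swap (by fun_prop)]
      refine lintegral_congr fun y => ?_
      rw [lintegral_lintegral_swap (by fun_prop)]
      refine lintegral_congr fun y' => ?_
      exact h_absorb (fun x _ _ => k (t - s) (x - y)) (by fun_prop)
        (fun _ _ _ => h_fst _ hts y) _ (by fun_prop)
    _ = ∫⁻ xt in S, ∫⁻ xt', ∫⁻ y, ∫⁻ y', ∫⁻ r in Set.Ioo s t, ∫⁻ z,
        k (r - s) (z - y') * (k (r - s) (z - y) * (k (t - r) (xt' - z) * k (t - r) (xt - z))) := by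
      rw [lintegral_lintegral_swap (by fun_prop)]
      refine lintegral_congr fun xt => ?_
      rw [lintegral_lintegral_swap (by fun_prop)]
      refine lintegral_congr fun xt' => ?_
      rw [lintegral_lintegral_swap (by fun_prop)]
      refine lintegral_congr fun y => ?_
      rw [lintegral_lintegral_swap (by fun_prop)]
      refine lintegral_congr fun y' => ?_
      rw [h_absorb (fun x' _ _ => k (t - s) (x' - y')) (by fun_prop)
        (fun _ _ _ => h_fst _ hts y') _ (by fun_prop)]
      refine lintegral_congr fun r => lintegral_congr fun z => ?_
      ring
    _ = ∫⁻ xt in S, ∫⁻ r in Set.Ioo s t, ∫⁻ z, k (t - r) (xt - z) := by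
      refine lintegral_congr fun xt => ?_
      have h_y' (xt' y : ℝ) := h_absorb (fun y' r z => k (r - s) (z - y')) (by fun_prop)
        (fun r hr z => h_snd _ (sub_pos.2 hr.1) z)
        (fun r z => k (r - s) (z - y) * (k (t - r) (xt' - z) * k (t - r) (xt - z))) (by fun_prop)
      have h_y (xt' : ℝ) := h_absorb (fun y r z => k (r - s) (z - y)) (by fun_prop)
        (fun r hr z => h_snd _ (sub_pos.2 hr.1) z)
        (fun r z => k (t - r) (xt' - z) * k (t - r) (xt - z)) (by fun_prop)
      simp_rw [h_y', h_y]
      exact h_absorb (fun xt' r z => k (t - r) (xt' - z)) (by fun_prop)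
        (fun r hr z => h_fst _ (sub_pos.2 hr.2) z) _ (by fun_prop)
    _ = ENNReal.ofReal (t - s) * volume S := by
      have h_z (xt : ℝ) : ∫⁻ r in Set.Ioo s t, ∫⁻ z, k (t - r) (xt - z) =
          ENNReal.ofReal (t - s) := by
        rw [setLIntegral_congr_fun measurableSet_Ioo
          fun r hr => h_snd (t - r) (sub_pos.2 hr.2) xt]
        simp
      simp_rw [h_z]
      simp

/-- The analytic core of the estimate of the term `A₂` in the proof of Theorem 1.1:
for `0 ≤ s < t` and `R > 0`, the eight-fold Gaussian integral
`∫_{[-R,R]⁴} ∫_{ℝ²} ∫_s^t ∫_ℝ p_{t-s}(x-y) p_{t-s}(x'-y') p_{t-r}(x̃-z)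
  p_{t-r}(x̃'-z) p_{r-s}(z-y) p_{r-s}(z-y') dz dr dy dy' dx dx' dx̃ dx̃'`
is bounded by `2R(t-s)`. -/
theorem A2_core_bound (s t R : ℝ) (hs : 0 ≤ s) (hst : s < t) (hR : 0 < R) :
    (∫ x in Set.Icc (-R) R, ∫ x' in Set.Icc (-R) R,
      ∫ xt in Set.Icc (-R) R, ∫ xt' in Set.Icc (-R) R,
        ∫ y : ℝ, ∫ y' : ℝ, ∫ r in Set.Ioo s t, ∫ z : ℝ,
          heatKernel (t - s) (x - y) * heatKernel (t - s) (x' - y') *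
          heatKernel (t - r) (xt - z) * heatKernel (t - r) (xt' - z) *
          heatKernel (r - s) (z - y) * heatKernel (r - s) (z - y'))
      ≤ 2 * R * (t - s) := by
  have hts : 0 < t - s := sub_pos.2 hst
  have h_vol : ENNReal.ofReal (t - s) * volume (Set.Icc (-R) R) =
      ENNReal.ofReal (2 * R * (t - s)) := by
    rw [Real.volume_Icc, ← ENNReal.ofReal_mul hts.le]
    congr 1
    ring
  refine (le_abs_self _).trans ?_
  rw [← ENNReal.ofReal_le_ofReal_iff (by positivity), ← Real.enorm_eq_ofReal_abs, ← h_vol,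
    ← lintegral_kernel_product_eq (k := fun a x => ‖heatKernel a x‖ₑ)
      (measurable_heatKernel.enorm) (fun _ => lintegral_enorm_heatKernel) hst]
  refine le_trans (enorm_integral_le_of_enorm_le fun x => ?_) (setLIntegral_le_lintegral _ _)
  refine le_trans (enorm_integral_le_of_enorm_le fun x' => ?_) (setLIntegral_le_lintegral _ _)
  refine enorm_integral_le_of_enorm_le fun xt => ?_
  refine le_trans (enorm_integral_le_of_enorm_le fun xt' => ?_) (setLIntegral_le_lintegral _ _)
  refine enorm_integral_le_of_enorm_le fun y => enorm_integral_le_of_enorm_le fun y' =>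
    enorm_integral_le_of_enorm_le fun r => enorm_integral_le_of_enorm_le fun z => ?_
  simp only [enorm_mul, le_refl]
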